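/- Let η > 0, ν₁ > 0, ν₂ > 0, c₁ > 0, M > 0 and k₀ ∈ ℕ. Let ρ: [0, η) → [0, ∞) be concave and continuous with ρ(0) = 0, continuously differentiable on (0, η) with ρ'(x) > 0 for all x ∈ (0, η). Let D* ∈ ℝ, let {D_k} ⊂ ℝ be nonincreasing, and let {s_k}, {u_k}, {v_k} be sequences in ℝᵖ such that for every k ≥ k₀: (a) 0 < D_k − D* < η; (b) ρ'(D_k − D*) · M · ‖v_k − u_k‖ ≥ 1; and (c) either D_k − D_{k+1} ≥ ν₁‖v_k − u_k‖² + ν₂‖s_{k+1} − s_k‖², or s_{k+1} − s_k = v_k − u_k and D_k − D_{k+1} ≥ c₁‖v_k − u_k‖². Then Σ_{k=k₀}^∞ ‖s_{k+1} − s_k‖ ≤ ρ(D_{k₀} − D*)/ā < ∞, where ā = min{2√(ν₁ν₂)/M, c₁/M}, and the sequence {s_k} converges in ℝᵖ. -/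

import Mathlib

open Filter Topology

noncomputable section

/-- `ℝᵖ` with the Euclidean norm. -/
abbrev E (p : ℕ) : Type := EuclideanSpace ℝ (Fin p)

/-- The tangent line of a concave function at `y` lies above the function to the left of `y`. -/
theorem ConcaveOn.hasDerivAt_mul_sub_le {S : Set ℝ} {f : ℝ → ℝ} {f' x y : ℝ}
    (hf : ConcaveOn ℝ S f) (hx : x ∈ S) (hy : y ∈ S) (hxy : x ≤ y) (hf' : HasDerivAt f f' y) :
    f' * (y - x) ≤ f y - f x := by
  rcases hxy.eq_or_lt with rfl | hlt
  · simp
  · have h := hf.le_slope_of_hasDerivAt hx hy hlt hf'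
    rwa [slope_def_field, le_div_iff₀ (sub_pos.2 hlt)] at h

theorem two_mul_sqrt_mul_mul_le {a b : ℝ} (ha : 0 ≤ a) (hb : 0 ≤ b) (x y : ℝ) :
    2 * Real.sqrt (a * b) * (x * y) ≤ a * x ^ 2 + b * y ^ 2 := by
  rw [Real.sqrt_mul ha]
  nlinarith [sq_nonneg (Real.sqrt a * x - Real.sqrt b * y), Real.sq_sqrt ha, Real.sq_sqrt hb]

/-- If `r * M * n ≥ 1` and the decrease `d` dominates `c * n * t`, then `r * d` dominates
`c / M * t`. -/
theorem div_mul_le_mul_of_one_le {r M n t c d : ℝ} (hr : 0 ≤ r) (hM : 0 < M) (hc : 0 ≤ c)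
    (ht : 0 ≤ t) (h : 1 ≤ r * M * n) (hd : c * (n * t) ≤ d) : c / M * t ≤ r * d := by
  calc c / M * t = c / M * t * 1 := (mul_one _).symm
    _ ≤ c / M * t * (r * M * n) := by gcongr
    _ = r * (c * (n * t)) := by field_simp
    _ ≤ r * d := by gcongr

/-- A nonnegative sequence dominated by the decrements of a nonnegative sequence has bounded
sum. -/
theorem summable_and_tsum_le_of_mul_le_sub {t φ : ℕ → ℝ} {a : ℝ} (ha : 0 < a)
    (ht : ∀ k, 0 ≤ t k) (hφ : ∀ k, 0 ≤ φ k) (h : ∀ k, a * t k ≤ φ k - φ (k + 1)) :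
    Summable t ∧ ∑' k, t k ≤ φ 0 / a := by
  have hsum : ∀ n, ∑ k ∈ Finset.range n, t k ≤ φ 0 / a := by
    intro n
    rw [le_div_iff₀' ha, Finset.mul_sum]
    calc ∑ k ∈ Finset.range n, a * t k ≤ ∑ k ∈ Finset.range n, (φ k - φ (k + 1)) :=
          Finset.sum_le_sum fun k _ => h k
      _ = φ 0 - φ n := Finset.sum_range_sub' φ n
      _ ≤ φ 0 := sub_le_self _ (hφ n)
  exact ⟨summable_of_sum_range_le ht hsum, Real.tsum_le_of_sum_range_le ht hsum⟩

/-- KL-based finite-length argument for the accelerated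
Douglas–Rachford/ADMM iteration.  Let `ρ` be a desingularizing function on `[0, η)`
(concave, continuous, `ρ(0) = 0`, `ρ ≥ 0`, with positive continuous derivative `ρd` on
`(0, η)`), let `D` be nonincreasing with `0 < D_k − D* < η`, assume the KL-type bound
`ρd(D_k − D*)·M·‖v_k − u_k‖ ≥ 1`, and assume the two-branch decrease condition (c) for
all `k ≥ k₀`.  Then `Σ_{k ≥ k₀} ‖s_{k+1} − s_k‖ ≤ ρ(D_{k₀} − D*)/ā` with
`ā = min{2√(ν₁ν₂)/M, c₁/M}` (in particular the series converges), and `{s_k}`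
converges. -/
theorem kl_finite_length
    {p : ℕ}
    (η ν₁ ν₂ c₁ M : ℝ)
    (hη : 0 < η) (hν₁ : 0 < ν₁) (hν₂ : 0 < ν₂) (hc₁ : 0 < c₁) (hM : 0 < M)
    (k₀ : ℕ)
    (ρ ρd : ℝ → ℝ)
    (hρ_nonneg : ∀ x ∈ Set.Ico (0 : ℝ) η, 0 ≤ ρ x)
    (hρ_concave : ConcaveOn ℝ (Set.Ico (0 : ℝ) η) ρ)
    (hρ_cont : ContinuousOn ρ (Set.Ico (0 : ℝ) η))
    (hρ_zero : ρ 0 = 0)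
    (hρ_deriv : ∀ x ∈ Set.Ioo (0 : ℝ) η, HasDerivAt ρ (ρd x) x)
    (hρd_cont : ContinuousOn ρd (Set.Ioo (0 : ℝ) η))
    (hρd_pos : ∀ x ∈ Set.Ioo (0 : ℝ) η, 0 < ρd x)
    (Dstar : ℝ) (D : ℕ → ℝ) (hD_anti : Antitone D)
    (s u v : ℕ → E p)
    (ha : ∀ k ≥ k₀, 0 < D k - Dstar ∧ D k - Dstar < η)
    (hb : ∀ k ≥ k₀, 1 ≤ ρd (D k - Dstar) * M * ‖v k - u k‖)
    (hc : ∀ k ≥ k₀,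
      ν₁ * ‖v k - u k‖ ^ 2 + ν₂ * ‖s (k + 1) - s k‖ ^ 2 ≤ D k - D (k + 1)
      ∨ (s (k + 1) - s k = v k - u k ∧ c₁ * ‖v k - u k‖ ^ 2 ≤ D k - D (k + 1))) :
    Summable (fun k : ℕ => ‖s (k₀ + k + 1) - s (k₀ + k)‖)
    ∧ (∑' k : ℕ, ‖s (k₀ + k + 1) - s (k₀ + k)‖)
        ≤ ρ (D k₀ - Dstar) / min (2 * Real.sqrt (ν₁ * ν₂) / M) (c₁ / M)
    ∧ ∃ slim : E p, Tendsto s atTop (𝓝 slim) := by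
  have hφ : ∀ k ≥ k₀, D k - Dstar ∈ Set.Ico (0 : ℝ) η := fun k hk =>
    ⟨(ha k hk).1.le, (ha k hk).2⟩
  have hstep : ∀ k ≥ k₀, min (2 * Real.sqrt (ν₁ * ν₂) / M) (c₁ / M) * ‖s (k + 1) - s k‖
      ≤ ρ (D k - Dstar) - ρ (D (k + 1) - Dstar) := by
    intro k hk
    have htangent := hρ_concave.hasDerivAt_mul_sub_le (hφ (k + 1) (by omega)) (hφ k hk)
      (sub_le_sub_right (hD_anti k.le_succ) Dstar) (hρ_deriv _ (ha k hk))
    rw [sub_sub_sub_cancel_right] at htangent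
    refine le_trans ?_ htangent
    have hr := (hρd_pos _ (ha k hk)).le
    rcases hc k hk with h | ⟨heq, h⟩
    · exact (mul_le_mul_of_nonneg_right (min_le_left _ _) (norm_nonneg _)).trans
        (div_mul_le_mul_of_one_le hr hM (by positivity) (norm_nonneg _) (hb k hk)
          ((two_mul_sqrt_mul_mul_le hν₁.le hν₂.le _ _).trans h))
    · refine (mul_le_mul_of_nonneg_right (min_le_right _ _) (norm_nonneg _)).trans
        (div_mul_le_mul_of_one_le hr hM hc₁.le (norm_nonneg _) (hb k hk) ?_)
      rwa [heq, ← sq]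
  obtain ⟨hsummable, hle⟩ := summable_and_tsum_le_of_mul_le_sub
    (t := fun k => ‖s (k₀ + k + 1) - s (k₀ + k)‖) (φ := fun k => ρ (D (k₀ + k) - Dstar))
    (lt_min (by positivity) (by positivity) : 0 < min (2 * Real.sqrt (ν₁ * ν₂) / M) (c₁ / M))
    (fun k => norm_nonneg _) (fun k => hρ_nonneg _ (hφ _ (by omega)))
    (fun k => hstep (k₀ + k) (by omega))
  refine ⟨hsummable, hle, ?_⟩
  have hcauchy : CauchySeq fun k => s (k + k₀) := by
    refine cauchySeq_of_summable_dist (hsummable.congr fun k => ?_)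
    rw [dist_comm, dist_eq_norm, Nat.succ_add, add_comm k k₀]
  obtain ⟨l, hl⟩ := cauchySeq_tendsto_of_complete hcauchy
  exact ⟨l, (tendsto_add_atTop_iff_nat k₀).1 hl⟩
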